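/- arXiv:2309.14313 — 2 statements merged into one kernel-verified Lean document; each statement's English description precedes it below -/
import Mathlib

section
/- For every α with 0 ≤ α < 1 there exists a constant c_α > 0, depending only on α, with the following property: for every n ≥ 1, every 1-separated set {x_1, …, x_n} ⊂ ℝ², and every point x ∈ ℝ² with ‖x − x_j‖ ≥ 1 for all 1 ≤ j ≤ n, one has Σ_{j=1}^{n} ‖x_j − x‖^{−(α+1)} ≤ c_α · n^{(1−α)/2}. -/
open MeasureTheory Module in
/-- A finite `1`-separated family contained in a closed ball of radius `R` has at most
`(2 * R + 1) ^ d` members, where `d` is the dimension. -/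
theorem card_le_two_mul_add_one_pow_finrank {ι E : Type*} [NormedAddCommGroup E] [NormedSpace ℝ E]
    [FiniteDimensional ℝ E] (s : Finset ι) (f : ι → E) (x : E) {R : ℝ} (hR : 0 ≤ R)
    (hsep : ∀ i ∈ s, ∀ j ∈ s, i ≠ j → 1 ≤ ‖f i - f j‖) (hball : ∀ i ∈ s, ‖f i - x‖ ≤ R) :
    (s.card : ℝ) ≤ (2 * R + 1) ^ finrank ℝ E := by
  borelize E
  let μ : Measure E := Measure.addHaar
  have hdisj : (s : Set ι).PairwiseDisjoint fun i => Metric.ball (f i) (1 / 2 : ℝ) := by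
    intro i hi j hj hij
    apply Metric.ball_disjoint_ball
    rw [dist_eq_norm]
    linarith [hsep i hi j hj hij]
  have hsub : (⋃ i ∈ s, Metric.ball (f i) (1 / 2 : ℝ)) ⊆ Metric.ball x (R + 1 / 2) := by
    refine Set.iUnion₂_subset fun i hi => Metric.ball_subset_ball' ?_
    rw [dist_eq_norm]
    linarith [hball i hi]
  have hvol : (s.card : ENNReal) * ENNReal.ofReal ((1 / 2 : ℝ) ^ finrank ℝ E) * μ (Metric.ball 0 1)
      ≤ ENNReal.ofReal ((R + 1 / 2) ^ finrank ℝ E) * μ (Metric.ball 0 1) := by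
    have h := measure_mono (μ := μ) hsub
    rw [measure_biUnion_finset hdisj fun i _ => measurableSet_ball,
      μ.addHaar_ball_of_pos x (by positivity)] at h
    simp only [μ.addHaar_ball_of_pos _ (by norm_num : (0 : ℝ) < 1 / 2), Finset.sum_const,
      nsmul_eq_mul, ← mul_assoc] at h
    exact h
  have hcancel := (ENNReal.mul_le_mul_iff_left (Metric.measure_ball_pos μ _ zero_lt_one).ne'
    measure_ball_lt_top.ne).1 hvol
  rw [← ENNReal.ofReal_natCast, ← ENNReal.ofReal_mul (by positivity),
    ENNReal.ofReal_le_ofReal_iff (by positivity)] at hcancel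
  calc (s.card : ℝ) = s.card * (1 / 2 : ℝ) ^ finrank ℝ E * 2 ^ finrank ℝ E := by
        rw [mul_assoc, ← mul_pow]; norm_num
    _ ≤ (R + 1 / 2) ^ finrank ℝ E * 2 ^ finrank ℝ E := by gcongr
    _ = (2 * R + 1) ^ finrank ℝ E := by rw [← mul_pow]; ring_nf

/-- The increment of `t ↦ t ^ p` on `[t, t + 1]` is at least its derivative at `t + 1`
for `0 ≤ p ≤ 1`. -/
theorem Real.rpow_add_mul_rpow_sub_one_le_rpow_add_one {p t : ℝ} (hp₀ : 0 ≤ p) (hp₁ : p ≤ 1)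
    (ht : 0 ≤ t) : t ^ p + p * (t + 1) ^ (p - 1) ≤ (t + 1) ^ p := by
  have hpos : 0 < t + 1 := by linarith
  have hle : (t + 1)⁻¹ ≤ 1 := inv_le_one_of_one_le₀ (by linarith)
  have hbern := rpow_one_add_le_one_add_mul_self (s := -(t + 1)⁻¹) (by linarith) hp₀ hp₁
  have hfac : t = (t + 1) * (1 + -(t + 1)⁻¹) := by field_simp; ring
  have hpow : t ^ p = (t + 1) ^ p * (1 + -(t + 1)⁻¹) ^ p := by
    conv_lhs => rw [hfac]
    exact Real.mul_rpow hpos.le (by linarith)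
  have hmul := mul_le_mul_of_nonneg_left hbern (Real.rpow_nonneg hpos.le p)
  rw [Real.rpow_sub_one hpos.ne', hpow, div_eq_mul_inv]
  linarith

/-- If every subfamily of the numbers `r i ≥ 1` with maximum `R` has at most `K * R ^ 2` members,
then the sum of the `n` powers `r i ^ (2 * (p - 1))` is at most `K / p * n ^ p`. -/
theorem Finset.sum_rpow_le_of_card_le_mul_sq {ι : Type*} (s : Finset ι) (r : ι → ℝ) {p K : ℝ}
    (hp₀ : 0 < p) (hp₁ : p ≤ 1) (hK : 1 ≤ K) (hr : ∀ i ∈ s, 1 ≤ r i)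
    (hcard : ∀ t ⊆ s, ∀ j ∈ t, (∀ i ∈ t, r i ≤ r j) → (t.card : ℝ) ≤ K * r j ^ 2) :
    ∑ i ∈ s, r i ^ (2 * (p - 1)) ≤ K / p * (s.card : ℝ) ^ p := by
  classical
  induction s using Finset.induction_on_max_value r with
  | empty => simp [Real.zero_rpow hp₀.ne']
  | insert a s ha hmax ih =>
    have ih := ih (fun i hi => hr i (mem_insert_of_mem hi))
      fun t ht => hcard t (ht.trans (subset_insert a s))
    have hra : 0 < r a := zero_lt_one.trans_le (hr a (mem_insert_self a s))
    have hc := hcard _ subset_rfl a (mem_insert_self a s) (by simpa using hmax)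
    rw [sum_insert ha]
    rw [card_insert_of_notMem ha, Nat.cast_add_one] at hc ⊢
    set m : ℝ := (s.card : ℝ)
    have hm : 0 ≤ m := Nat.cast_nonneg _
    have hm₁ : 0 < m + 1 := by linarith
    have hK₀ : 0 < K := by linarith
    have hterm : r a ^ (2 * (p - 1)) ≤ K * (m + 1) ^ (p - 1) := by
      calc r a ^ (2 * (p - 1)) = (r a ^ 2) ^ (p - 1) := by
            rw [Real.rpow_mul hra.le, Real.rpow_two]
        _ ≤ ((m + 1) / K) ^ (p - 1) :=
            Real.rpow_le_rpow_of_nonpos (by positivity)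
              ((div_le_iff₀' hK₀).2 hc) (by linarith)
        _ = K ^ (1 - p) * (m + 1) ^ (p - 1) := by
            rw [Real.div_rpow hm₁.le hK₀.le, ← neg_sub p 1, Real.rpow_neg hK₀.le]
            ring
        _ ≤ K * (m + 1) ^ (p - 1) := by
            gcongr
            exact (Real.rpow_le_rpow_of_exponent_le hK (by linarith)).trans_eq (Real.rpow_one K)
    calc r a ^ (2 * (p - 1)) + ∑ i ∈ s, r i ^ (2 * (p - 1))
        ≤ K * (m + 1) ^ (p - 1) + K / p * m ^ p := add_le_add hterm ih
      _ = K / p * (m ^ p + p * (m + 1) ^ (p - 1)) := by field_simp; ring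
      _ ≤ K / p * (m + 1) ^ p := by
          gcongr
          exact Real.rpow_add_mul_rpow_sub_one_le_rpow_add_one hp₀.le hp₁ hm


/-- **Packing bound in the plane** (used in Lemma 2 of the paper): for `0 ≤ α < 1`
there is `c_α > 0` such that for any `1`-separated points `x_1, …, x_n ∈ ℝ²` and any
point `x` at distance at least `1` from all of them,
`Σ_j ‖x_j − x‖^{−(α+1)} ≤ c_α · n^{(1−α)/2}`. -/
theorem packing_sum_bound_plane (α : ℝ) (hα₀ : 0 ≤ α) (hα₁ : α < 1) :
    ∃ c : ℝ, 0 < c ∧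
      ∀ (n : ℕ), 1 ≤ n →
        ∀ xs : Fin n → EuclideanSpace ℝ (Fin 2),
          (∀ i j, i ≠ j → 1 ≤ ‖xs i - xs j‖) →
          ∀ x : EuclideanSpace ℝ (Fin 2), (∀ j, 1 ≤ ‖x - xs j‖) →
            ∑ j, ‖xs j - x‖ ^ (-(α + 1)) ≤ c * (n : ℝ) ^ ((1 - α) / 2) := by
  have hp : 0 < (1 - α) / 2 := by linarith
  refine ⟨9 / ((1 - α) / 2), by positivity, fun n _ xs hsep x hx => ?_⟩
  have hr : ∀ j, 1 ≤ ‖xs j - x‖ := fun j => norm_sub_rev x (xs j) ▸ hx j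
  have hsum := Finset.univ.sum_rpow_le_of_card_le_mul_sq (fun j => ‖xs j - x‖) (K := 9) hp
    (by linarith) (by norm_num) (fun j _ => hr j) fun t _ j _ hmax => by
      have h := card_le_two_mul_add_one_pow_finrank t xs x (norm_nonneg (xs j - x))
        (fun i _ k _ => hsep i k) hmax
      rw [finrank_euclideanSpace_fin] at h
      nlinarith [hr j]
  rw [Finset.card_univ, Fintype.card_fin] at hsum
  convert hsum using 3
  ring
end

section
/- For every dimension d ≥ 3 there exists a constant c_d > 0, depending only on d, with the following property: for every n ≥ 1, every 1-separated set {x_1, …, x_n} ⊂ ℝ^d, and every point x ∈ ℝ^d with ‖x − x_j‖ ≥ 1 for all 1 ≤ j ≤ n, one has Σ_{j=1}^{n} ‖x_j − x‖^{−(d−1)} ≤ c_d · n^{1/d}. -/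
open MeasureTheory Module in
/-- Volume bound for the number of `1`-separated points in a ball of radius `R ≥ 0`. -/
theorem card_le_of_one_separated_of_norm_sub_le {ι E : Type*} [NormedAddCommGroup E]
    [NormedSpace ℝ E] [FiniteDimensional ℝ E] (s : Finset ι) (xs : ι → E)
    (hsep : ∀ i ∈ s, ∀ j ∈ s, i ≠ j → 1 ≤ ‖xs i - xs j‖) (x : E) {R : ℝ} (hR : 0 ≤ R)
    (hs : ∀ i ∈ s, ‖xs i - x‖ ≤ R) : (s.card : ℝ) ≤ (2 * R + 1) ^ finrank ℝ E := by
  borelize E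
  let μ : Measure E := Measure.addHaar
  have hρ : 0 < R + 1 / 2 := by positivity
  have hdisj : Set.Pairwise (s : Set ι)
      (Function.onFun Disjoint fun i => Metric.ball (xs i) (1 / 2 : ℝ)) := by
    intro i hi j hj hij
    apply Metric.ball_disjoint_ball
    rw [dist_eq_norm]
    linarith [hsep i hi j hj hij]
  have hsub : ⋃ i ∈ s, Metric.ball (xs i) (1 / 2 : ℝ) ⊆ Metric.ball x (R + 1 / 2) := by
    refine Set.iUnion₂_subset fun i hi => Metric.ball_subset_ball' ?_
    rw [dist_eq_norm]
    linarith [hs i hi]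
  have hvol : (s.card : ENNReal) * ENNReal.ofReal ((1 / 2 : ℝ) ^ finrank ℝ E)
      * μ (Metric.ball 0 1) ≤
      ENNReal.ofReal ((R + 1 / 2) ^ finrank ℝ E) * μ (Metric.ball 0 1) := by
    have := measure_mono (μ := μ) hsub
    rw [measure_biUnion_finset hdisj fun _ _ => Metric.isOpen_ball.measurableSet] at this
    simpa only [μ.addHaar_ball_of_pos _ hρ, μ.addHaar_ball_of_pos _ (one_half_pos (α := ℝ)),
      Finset.sum_const, nsmul_eq_mul, mul_assoc] using this
  have hcard : (s.card : ℝ) * (1 / 2 : ℝ) ^ finrank ℝ E ≤ (R + 1 / 2) ^ finrank ℝ E := by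
    have := ENNReal.toReal_le_of_le_ofReal (by positivity)
      ((ENNReal.mul_le_mul_iff_left (Metric.measure_ball_pos _ _ zero_lt_one).ne'
        measure_ball_lt_top.ne).1 hvol)
    rwa [ENNReal.toReal_mul, ENNReal.toReal_natCast,
      ENNReal.toReal_ofReal (by positivity)] at this
  have hsplit : (R + 1 / 2) ^ finrank ℝ E =
      (2 * R + 1) ^ finrank ℝ E * (1 / 2 : ℝ) ^ finrank ℝ E := by
    rw [← mul_pow]
    ring_nf
  rw [hsplit] at hcard
  exact le_of_mul_le_mul_right hcard (by positivity)

/-- Discrete form of `∫ t ^ (b - 1) = t ^ b / b`, from concavity of `t ↦ t ^ b`. -/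
theorem mul_rpow_sub_one_le_rpow_sub_rpow {t b : ℝ} (ht : 0 ≤ t) (hb : 0 ≤ b) (hb1 : b ≤ 1) :
    b * (t + 1) ^ (b - 1) ≤ (t + 1) ^ b - t ^ b := by
  have ht1 : 0 < t + 1 := by positivity
  have hle : (t + 1)⁻¹ ≤ 1 := inv_le_one_of_one_le₀ (by linarith)
  have hbern := rpow_one_add_le_one_add_mul_self (s := -(t + 1)⁻¹) (by linarith) hb hb1
  have hfac : t = (t + 1) * (1 + -(t + 1)⁻¹) := by field_simp; ring
  have hpow : t ^ b = (t + 1) ^ b * (1 + -(t + 1)⁻¹) ^ b := by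
    rw [← Real.mul_rpow ht1.le (by linarith), ← hfac]
  have hmul := mul_le_mul_of_nonneg_left hbern (Real.rpow_nonneg ht1.le b)
  rw [Real.rpow_sub_one ht1.ne', hpow, div_eq_mul_inv]
  linarith

/-- If `N ≤ (3 r) ^ d` then `r ^ (-(d - 1))` is controlled by `N ^ (1 / d - 1)`. -/
theorem rpow_neg_le_of_le_three_mul_pow {d : ℕ} (hd : 1 ≤ d) {N r : ℝ} (hN : 0 < N)
    (hr : 0 < r) (h : N ≤ (3 * r) ^ d) :
    r ^ (-((d : ℝ) - 1)) ≤ 3 ^ ((d : ℝ) - 1) * N ^ ((1 : ℝ) / d - 1) := by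
  have hd1 : (1 : ℝ) ≤ d := by exact_mod_cast hd
  have hroot : N ^ ((1 : ℝ) / d) ≤ 3 * r := by
    rw [one_div]
    exact (Real.rpow_inv_le_iff_of_pos hN.le (by positivity) (by positivity)).2
      (by rwa [Real.rpow_natCast])
  have hanti : (3 * r) ^ (-((d : ℝ) - 1)) ≤ (N ^ ((1 : ℝ) / d)) ^ (-((d : ℝ) - 1)) :=
    Real.rpow_le_rpow_of_nonpos (by positivity) hroot (by linarith)
  have hexp : (1 : ℝ) / d * (-((d : ℝ) - 1)) = 1 / d - 1 := by field_simp; ring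
  rw [← Real.rpow_mul hN.le, hexp, Real.mul_rpow (by norm_num) hr.le,
    Real.rpow_neg (by norm_num), inv_mul_le_iff₀ (by positivity)] at hanti
  exact hanti

/-- The packing bound for a finite family indexed by a finset, with explicit constant. -/
theorem sum_rpow_neg_le_of_one_separated {ι : Type*} {d : ℕ} (hd : 1 ≤ d) (s : Finset ι)
    (xs : ι → EuclideanSpace ℝ (Fin d)) (x : EuclideanSpace ℝ (Fin d))
    (hsep : ∀ i ∈ s, ∀ j ∈ s, i ≠ j → 1 ≤ ‖xs i - xs j‖) (hx : ∀ i ∈ s, 1 ≤ ‖xs i - x‖) :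
    ∑ i ∈ s, ‖xs i - x‖ ^ (-((d : ℝ) - 1)) ≤
      3 ^ ((d : ℝ) - 1) * d * (s.card : ℝ) ^ ((1 : ℝ) / d) := by
  classical
  have hd1 : (1 : ℝ) ≤ d := by exact_mod_cast hd
  induction s using Finset.induction_on_max_value (fun i => ‖xs i - x‖) with
  | empty =>
    simp only [Finset.sum_empty]
    positivity
  | insert a s ha hmax ih =>
    have ih := ih (fun i hi j hj => hsep i (Finset.mem_insert_of_mem hi) j
      (Finset.mem_insert_of_mem hj)) fun i hi => hx i (Finset.mem_insert_of_mem hi)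
    have hra : 1 ≤ ‖xs a - x‖ := hx a (Finset.mem_insert_self a s)
    have hcard := card_le_of_one_separated_of_norm_sub_le (insert a s) xs hsep x
      (norm_nonneg (xs a - x)) (by simpa using hmax)
    rw [finrank_euclideanSpace_fin, Finset.card_insert_of_notMem ha, Nat.cast_add_one] at hcard
    have hterm := rpow_neg_le_of_le_three_mul_pow hd (by positivity) (by linarith)
      (hcard.trans (pow_le_pow_left₀ (by positivity)
        (show 2 * ‖xs a - x‖ + 1 ≤ 3 * ‖xs a - x‖ by linarith) d))
    have hstep := mul_rpow_sub_one_le_rpow_sub_rpow (t := s.card) (b := 1 / d) (by positivity)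
      (by positivity) ((div_le_one₀ (by positivity)).2 hd1)
    rw [one_div, inv_mul_le_iff₀ (by positivity), ← one_div] at hstep
    have hscaled := mul_le_mul_of_nonneg_left hstep
      (show (0 : ℝ) ≤ 3 ^ ((d : ℝ) - 1) by positivity)
    rw [Finset.sum_insert ha, Finset.card_insert_of_notMem ha, Nat.cast_add_one]
    linarith


/-- **Packing bound in `ℝ^d`** (used in the proof of Theorem 4): for `d ≥ 3`
there is `c_d > 0` such that for any `1`-separated points `x_1, …, x_n ∈ ℝ^d` and any
point `x` at distance at least `1` from all of them,
`Σ_j ‖x_j − x‖^{−(d−1)} ≤ c_d · n^{1/d}`. -/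
theorem packing_sum_bound_higher_dim (d : ℕ) (hd : 3 ≤ d) :
    ∃ c : ℝ, 0 < c ∧
      ∀ (n : ℕ), 1 ≤ n →
        ∀ xs : Fin n → EuclideanSpace ℝ (Fin d),
          (∀ i j, i ≠ j → 1 ≤ ‖xs i - xs j‖) →
          ∀ x : EuclideanSpace ℝ (Fin d), (∀ j, 1 ≤ ‖x - xs j‖) →
            ∑ j, ‖xs j - x‖ ^ (-((d : ℝ) - 1)) ≤ c * (n : ℝ) ^ ((1 : ℝ) / d) := by
  refine ⟨3 ^ ((d : ℝ) - 1) * d, by positivity, fun n _ xs hsep x hx => ?_⟩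
  simpa using sum_rpow_neg_le_of_one_separated (by omega : 1 ≤ d) Finset.univ xs x
    (fun i _ j _ => hsep i j) fun j _ => norm_sub_rev x (xs j) ▸ hx j
end
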